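/- arXiv:2507.19288 — 3 statements merged into one kernel-verified Lean document; each statement's English description precedes it below -/
import Mathlib

section
/- Let d ≥ 1, let φ, θ ≥ 0 be real numbers, let p ∈ [1,∞) be real, let M, E ∈ [0,∞), and let g: ℝ^d → [0,∞) be measurable with g(z) ≤ M for all z ∈ ℝ^d and |z|^φ g(z) ≤ E for all z ∈ ℝ^d. Then for every u ∈ ℝ^d, ( ∫_{ℝ^d} (|x|^φ g(x) g(u+x))^p dx )^{1/p} ≤ ( ∫_{ℝ^d} (|x|^φ |u+x|^θ g(x) g(u+x))^p dx )^{1/p} + M · E · V_d^{1/p}, where V_d denotes the Lebesgue measure of the Euclidean unit ball {z ∈ ℝ^d : |z| ≤ 1}. -/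
open MeasureTheory
open scoped ENNReal

/-- If `g(z) ≤ M` and `|z|^φ g(z) ≤ E` pointwise, then for `p ∈ [1,∞)` and every `u`,
`‖ |x|^φ g(x) g(u+x) ‖_{L^p_x} ≤ ‖ |x|^φ |u+x|^θ g(x) g(u+x) ‖_{L^p_x} + M·E·V_d^{1/p}`,
where `V_d` is the volume of the Euclidean unit ball in `ℝ^d`. -/
theorem weighted_bubble_reduction (d : ℕ) (hd : 1 ≤ d) (φ θ : ℝ) (hφ : 0 ≤ φ)
    (hθ : 0 ≤ θ) (p : ℝ) (hp : 1 ≤ p) (M E : ℝ) (hM : 0 ≤ M) (hE : 0 ≤ E)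
    (g : EuclideanSpace ℝ (Fin d) → ℝ) (hgmeas : Measurable g) (hg0 : ∀ z, 0 ≤ g z)
    (hgM : ∀ z, g z ≤ M) (hgE : ∀ z, ‖z‖ ^ φ * g z ≤ E)
    (u : EuclideanSpace ℝ (Fin d)) :
    (∫⁻ x, ENNReal.ofReal ((‖x‖ ^ φ * g x * g (u + x)) ^ p)) ^ (1 / p) ≤
      (∫⁻ x, ENNReal.ofReal ((‖x‖ ^ φ * ‖u + x‖ ^ θ * g x * g (u + x)) ^ p)) ^ (1 / p) +
        ENNReal.ofReal (M * E *
          (volume (Metric.closedBall (0 : EuclideanSpace ℝ (Fin d)) 1)).toReal ^ (1 / p)) := by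
  have hp0 : 0 < p := one_pos.trans_le hp
  set S : Set (EuclideanSpace ℝ (Fin d)) := Metric.closedBall (-u) 1 with hS
  have hmem (x : EuclideanSpace ℝ (Fin d)) : x ∈ S ↔ ‖u + x‖ ≤ 1 := by
    rw [hS, mem_closedBall_iff_norm, sub_neg_eq_add, add_comm]
  have hA (x) : 0 ≤ ‖x‖ ^ φ * g x * g (u + x) := by
    have := hg0 x
    have := hg0 (u + x)
    positivity
  have hB (x) : 0 ≤ ‖x‖ ^ φ * ‖u + x‖ ^ θ * g x * g (u + x) := by
    have := hg0 x
    have := hg0 (u + x)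
    positivity
  have hfm : Measurable fun x ↦
      ENNReal.ofReal (‖x‖ ^ φ * ‖u + x‖ ^ θ * g x * g (u + x)) := by
    fun_prop
  have hhm : Measurable (S.indicator fun _ ↦ ENNReal.ofReal (M * E)) :=
    measurable_const.indicator Metric.isClosed_closedBall.measurableSet
  have hpoint (x) : ENNReal.ofReal (‖x‖ ^ φ * g x * g (u + x)) ≤
      ENNReal.ofReal (‖x‖ ^ φ * ‖u + x‖ ^ θ * g x * g (u + x)) +
        S.indicator (fun _ ↦ ENNReal.ofReal (M * E)) x := by
    by_cases hx : x ∈ S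
    · rw [Set.indicator_of_mem hx]
      refine le_add_left (ENNReal.ofReal_le_ofReal ?_)
      rw [mul_comm M E]
      exact mul_le_mul (hgE x) (hgM _) (hg0 _) hE
    · refine le_add_right (ENNReal.ofReal_le_ofReal ?_)
      have h1 : 1 ≤ ‖u + x‖ ^ θ :=
        Real.one_le_rpow (not_le.mp fun h ↦ hx ((hmem x).mpr h)).le hθ
      calc ‖x‖ ^ φ * g x * g (u + x) ≤ ‖u + x‖ ^ θ * (‖x‖ ^ φ * g x * g (u + x)) :=
            le_mul_of_one_le_left (hA x) h1
        _ = _ := by ring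
  have hind : (∫⁻ x, S.indicator (fun _ ↦ ENNReal.ofReal (M * E)) x ^ p) ^ (1 / p) =
      ENNReal.ofReal (M * E *
        (volume (Metric.closedBall (0 : EuclideanSpace ℝ (Fin d)) 1)).toReal ^ (1 / p)) := by
    have hpow (x) : S.indicator (fun _ ↦ ENNReal.ofReal (M * E)) x ^ p =
        S.indicator (fun _ ↦ ENNReal.ofReal (M * E) ^ p) x := by
      by_cases hx : x ∈ S <;> simp [hx, hp0]
    simp_rw [hpow]
    rw [lintegral_indicator_const Metric.isClosed_closedBall.measurableSet,
      ENNReal.mul_rpow_of_nonneg _ _ (by positivity), ← ENNReal.rpow_mul,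
      mul_one_div_cancel hp0.ne', ENNReal.rpow_one, ENNReal.ofReal_mul (mul_nonneg hM hE),
      ← ENNReal.ofReal_rpow_of_nonneg ENNReal.toReal_nonneg (by positivity),
      ENNReal.ofReal_toReal measure_closedBall_lt_top.ne, Measure.addHaar_closedBall_center]
  simp_rw [← ENNReal.ofReal_rpow_of_nonneg (hA _) hp0.le,
    ← ENNReal.ofReal_rpow_of_nonneg (hB _) hp0.le]
  rw [← hind]
  refine le_trans ?_ (ENNReal.lintegral_Lp_add_le hfm.aemeasurable hhm.aemeasurable hp)
  gcongr with x
  exact hpoint x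
end

section
/- Let d ≥ 1, θ ≥ 0, p ∈ [1,∞) real, E, B, T ∈ [0,∞), and let τ: ℝ^d → [0,∞) be measurable and even (τ(−z) = τ(z) for all z), with |z|^θ τ(z) ≤ E, (τ*τ)(z) ≤ B, and ((|·|^θ τ)*τ*τ)(z) ≤ T for all z ∈ ℝ^d, where (|·|^θ τ)(z) = |z|^θ τ(z). Then for every u ∈ ℝ^d, ( ∫_{ℝ^d} (|x|^θ τ(x) · (τ*τ)(u+x))^p dx )^{1/p} ≤ T + E · B. -/
open MeasureTheory
open scoped ENNReal

/-- Logarithmic convexity: an `L^p` norm is controlled by an `L¹` bound and a sup bound. -/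
theorem lintegral_rpow_rpow_inv_le_add {α : Type*} [MeasurableSpace α] {μ : Measure α}
    {f : α → ℝ≥0∞} {a b : ℝ≥0∞} {p : ℝ} (hp : 1 ≤ p) (hb : b ≠ ∞)
    (hfb : ∀ x, f x ≤ b) (hfa : ∫⁻ x, f x ∂μ ≤ a) :
    (∫⁻ x, f x ^ p ∂μ) ^ (1 / p) ≤ a + b := by
  have hp1 : 0 ≤ p - 1 := by linarith
  rw [one_div, ENNReal.rpow_inv_le_iff (by linarith)]
  have split : ∀ t : ℝ≥0∞, t ^ p = t ^ (p - 1) * t := fun t => by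
    simpa using ENNReal.rpow_add_of_nonneg (x := t) (p - 1) 1 hp1 zero_le_one
  calc ∫⁻ x, f x ^ p ∂μ ≤ ∫⁻ x, b ^ (p - 1) * f x ∂μ := by
        refine lintegral_mono fun x => ?_
        rw [split]
        gcongr
        exact hfb x
    _ = b ^ (p - 1) * ∫⁻ x, f x ∂μ :=
        lintegral_const_mul' _ _ (ENNReal.rpow_ne_top_of_nonneg hp1 hb)
    _ ≤ (a + b) ^ (p - 1) * (a + b) := by
        gcongr
        · exact le_add_self
        · exact hfa.trans le_self_add
    _ = (a + b) ^ p := (split _).symm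

/-- Weighted open-triangle estimate: if `τ` is even, `|z|^θ τ(z) ≤ E`, `(τ*τ)(z) ≤ B`,
and `((|·|^θ τ)*τ*τ)(z) ≤ T` pointwise, then for `p ∈ [1,∞)` and every `u`,
`‖ |x|^θ τ(x) (τ*τ)(u+x) ‖_{L^p_x} ≤ T + E·B`. -/
theorem weighted_triangle_Lp_bound (d : ℕ) (hd : 1 ≤ d) (θ : ℝ) (hθ : 0 ≤ θ)
    (p : ℝ) (hp : 1 ≤ p) (E B T : ℝ) (hE : 0 ≤ E) (hB : 0 ≤ B) (hT : 0 ≤ T)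
    (τ : EuclideanSpace ℝ (Fin d) → ℝ) (hτmeas : Measurable τ) (hτ0 : ∀ z, 0 ≤ τ z)
    (hτeven : ∀ z, τ (-z) = τ z)
    (hτE : ∀ z, ‖z‖ ^ θ * τ z ≤ E)
    (hτB : ∀ z : EuclideanSpace ℝ (Fin d),
      (∫⁻ y, ENNReal.ofReal (τ y * τ (z - y))) ≤ ENNReal.ofReal B)
    (hτT : ∀ z : EuclideanSpace ℝ (Fin d),
      (∫⁻ z₁, ∫⁻ z₂, ENNReal.ofReal ((‖z₁‖ ^ θ * τ z₁) * τ (z₂ - z₁) * τ (z - z₂))) ≤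
        ENNReal.ofReal T)
    (u : EuclideanSpace ℝ (Fin d)) :
    (∫⁻ x, (ENNReal.ofReal (‖x‖ ^ θ * τ x) *
        ∫⁻ y, ENNReal.ofReal (τ y * τ (u + x - y))) ^ p) ^ (1 / p) ≤
      ENNReal.ofReal (T + E * B) := by
  have hw0 : ∀ z, 0 ≤ ‖z‖ ^ θ * τ z := fun z => mul_nonneg (by positivity) (hτ0 z)
  rw [ENNReal.ofReal_add hT (mul_nonneg hE hB)]
  refine lintegral_rpow_rpow_inv_le_add hp ENNReal.ofReal_ne_top (fun x => ?_) ?_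
  · rw [ENNReal.ofReal_mul hE]
    gcongr
    · exact hτE x
    · exact hτB (u + x)
  · refine le_trans (le_of_eq (lintegral_congr fun x => ?_)) (hτT (-u))
    rw [← lintegral_const_mul' _ _ ENNReal.ofReal_ne_top,
      ← lintegral_sub_left_eq_self _ x]
    refine lintegral_congr fun z => ?_
    rw [← ENNReal.ofReal_mul (hw0 x), ← hτeven (x - z), ← hτeven (u + x - (x - z)),
      ← mul_assoc, neg_sub, show -(u + x - (x - z)) = -u - z by abel]
end

section
/- Let d ≥ 1, let f: ℝ^d → [0,∞) be a function, and let C ≥ 0. Suppose that for all k, x ∈ ℝ^d one has (1 − cos(⟨k,x⟩)) · f(x) ≤ C · |k|², where ⟨·,·⟩ is the Euclidean inner product. Then |x|² f(x) ≤ 2 d C for all x ∈ ℝ^d. -/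
open scoped RealInnerProductSpace

open Filter Topology in
theorem tendsto_one_sub_cos_mul_div_sq (a : ℝ) :
    Tendsto (fun t : ℝ => (1 - Real.cos (t * a)) / t ^ 2) (𝓝[≠] 0) (𝓝 (a ^ 2 / 2)) := by
  have hd : HasDerivAt (fun t : ℝ => Real.sin (t * (a / 2))) (a / 2) 0 := by
    simpa using ((hasDerivAt_id (0 : ℝ)).mul_const (a / 2)).sin
  have hs : Tendsto (fun t : ℝ => t⁻¹ * Real.sin (t * (a / 2))) (𝓝[≠] 0) (𝓝 (a / 2)) := by
    simpa using hd.tendsto_slope_zero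
  convert (hs.pow 2).const_mul 2 using 2 with t
  · have hcos : Real.cos (t * a) = 1 - 2 * Real.sin (t * (a / 2)) ^ 2 := by
      rw [← Real.cos_two_mul_eq_one_sub]
      ring_nf
    rw [hcos]
    ring
  · ring

theorem sq_mul_le_of_one_sub_cos_mul_le {a c B : ℝ}
    (h : ∀ t : ℝ, (1 - Real.cos (t * a)) * c ≤ B * t ^ 2) : a ^ 2 * c ≤ 2 * B := by
  have hlim : a ^ 2 / 2 * c ≤ B := by
    refine le_of_tendsto ((tendsto_one_sub_cos_mul_div_sq a).mul_const c) ?_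
    filter_upwards [self_mem_nhdsWithin] with t ht
    have ht : 0 < t ^ 2 := sq_pos_of_ne_zero ht
    rw [div_mul_eq_mul_div, div_le_iff₀ ht]
    exact h t
  linarith

/-- If `(1 − cos⟨k,x⟩) f(x) ≤ C‖k‖²` for all `k, x ∈ ℝ^d`, then
`‖x‖² f(x) ≤ 2dC` for all `x`. -/
theorem cosine_bound_to_second_moment (d : ℕ) (hd : 1 ≤ d)
    (f : EuclideanSpace ℝ (Fin d) → ℝ) (hf0 : ∀ x, 0 ≤ f x)
    (C : ℝ) (hC : 0 ≤ C)
    (h : ∀ k x : EuclideanSpace ℝ (Fin d), (1 - Real.cos ⟪k, x⟫) * f x ≤ C * ‖k‖ ^ 2) :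
    ∀ x : EuclideanSpace ℝ (Fin d), ‖x‖ ^ 2 * f x ≤ 2 * d * C := by
  intro x
  have hcoord (j : Fin d) : x j ^ 2 * f x ≤ 2 * C := by
    refine sq_mul_le_of_one_sub_cos_mul_le fun t => ?_
    simpa [EuclideanSpace.inner_single_left] using h (EuclideanSpace.single j t) x
  calc ‖x‖ ^ 2 * f x = ∑ j, x j ^ 2 * f x := by
        rw [EuclideanSpace.real_norm_sq_eq, Finset.sum_mul]
    _ ≤ ∑ _j : Fin d, 2 * C := Finset.sum_le_sum fun j _ => hcoord j
    _ = 2 * d * C := by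
        simp only [Finset.sum_const, Finset.card_univ, Fintype.card_fin, nsmul_eq_mul]
        ring
end
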